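/- Let (f_0,…,f_5) be a rational solution of A_5(α_0,…,α_5) such that for some i ∈ {0,…,5}, f_i and f_{i+2} have a pole at t = 0 and f_{i+1}, f_{i+3}, f_{i+4}, f_{i+5} are regular at t = 0. Set r = α_{i+1} − α_{i+3} − α_{i+5}. Then r ≠ 0 and, as t → 0: t·f_i(t) → r, t·f_{i+2}(t) → −r, f_{i+1}(t)/t → α_{i+1}/r, f_{i+3}(t)/t → −α_{i+3}/r, f_{i+5}(t)/t → −α_{i+5}/r, and f_{i+4}(t) → 0. In particular f_i and f_{i+2} have simple poles at t = 0 with residues r and −r respectively. -/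

import Mathlib

open Filter Topology Polynomial

noncomputable section

/-- Evaluation of a complex rational function at a point (junk value where the
reduced denominator vanishes). -/
def evalR (f : RatFunc ℂ) (t : ℂ) : ℂ := RatFunc.eval (RingHom.id ℂ) t f

/-- `f` is defined at `t`: the reduced denominator does not vanish at `t`. -/
def DefinedAt (f : RatFunc ℂ) (t : ℂ) : Prop := Polynomial.eval t (RatFunc.denom f) ≠ 0

/-- `(f 0, …, f 5)` is a rational solution of the `A₅⁽¹⁾` Painlevé system `A₅(α)`:
the two constraints hold identically as rational functions, and the six ODEs hold at
every point where all six components are defined.  (Indices are taken in `Fin 6`,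
i.e. modulo `6`.) -/
def IsA5Solution (α : Fin 6 → ℂ) (f : Fin 6 → RatFunc ℂ) : Prop :=
  f 0 + f 2 + f 4 = RatFunc.X ∧
  f 1 + f 3 + f 5 = RatFunc.X ∧
  ∀ t : ℂ, (∀ j : Fin 6, DefinedAt (f j) t) → ∀ i : Fin 6,
    t / 2 * deriv (evalR (f i)) t =
      evalR (f i) t *
        (evalR (f (i + 1)) t * evalR (f (i + 2)) t
          + evalR (f (i + 1)) t * evalR (f (i + 4)) t
          + evalR (f (i + 3)) t * evalR (f (i + 4)) t
          - evalR (f (i + 2)) t * evalR (f (i + 3)) t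
          - evalR (f (i + 2)) t * evalR (f (i + 5)) t
          - evalR (f (i + 4)) t * evalR (f (i + 5)) t)
      + (1 / 2 - α (i + 2) - α (i + 4)) * evalR (f i) t
      + α i * (evalR (f (i + 2)) t + evalR (f (i + 4)) t)

/-- `f` has a pole at `t = ∞`: `‖f t‖ → ∞` as `‖t‖ → ∞`. -/
def PoleAtInfty (f : RatFunc ℂ) : Prop :=
  Tendsto (fun t => ‖evalR f t‖) (Bornology.cobounded ℂ) atTop

/-- `f` is holomorphic at `t = ∞`: `f` is bounded as `‖t‖ → ∞`. -/
def HoloAtInfty (f : RatFunc ℂ) : Prop :=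
  IsBoundedUnder (· ≤ ·) (Bornology.cobounded ℂ) fun t => ‖evalR f t‖

/-- `f` has a pole at `c ∈ ℂ`: `‖f t‖ → ∞` as `t → c`. -/
def PoleAt (f : RatFunc ℂ) (c : ℂ) : Prop :=
  Tendsto (fun t => ‖evalR f t‖) (𝓝[≠] c) atTop

/-- `f` is regular at `c ∈ ℂ`: it extends continuously to `c`. -/
def RegularAt (f : RatFunc ℂ) (c : ℂ) : Prop :=
  ∃ L : ℂ, Tendsto (fun t => evalR f t) (𝓝[≠] c) (𝓝 L)

/-- `z` is an integer. -/
def IsInt (z : ℂ) : Prop := ∃ n : ℤ, z = (n : ℂ)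

/-- `z` is an even integer. -/
def IsEvenInt (z : ℂ) : Prop := ∃ n : ℤ, z = 2 * (n : ℂ)

/-- A tuple of rational functions has pole configuration of Type A at `t = ∞`. -/
def TypeA (f : Fin 6 → RatFunc ℂ) : Prop :=
  ∃ i : Fin 6,
    (PoleAtInfty (f i) ∧ PoleAtInfty (f (i + 1)) ∧ HoloAtInfty (f (i + 2)) ∧
      HoloAtInfty (f (i + 3)) ∧ HoloAtInfty (f (i + 4)) ∧ HoloAtInfty (f (i + 5))) ∨
    (PoleAtInfty (f i) ∧ PoleAtInfty (f (i + 3)) ∧ HoloAtInfty (f (i + 1)) ∧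
      HoloAtInfty (f (i + 2)) ∧ HoloAtInfty (f (i + 4)) ∧ HoloAtInfty (f (i + 5))) ∨
    (PoleAtInfty (f i) ∧ PoleAtInfty (f (i + 1)) ∧ PoleAtInfty (f (i + 2)) ∧
      PoleAtInfty (f (i + 4)) ∧ HoloAtInfty (f (i + 3)) ∧ HoloAtInfty (f (i + 5)))

/-- A tuple of rational functions has pole configuration of Type B at `t = ∞`. -/
def TypeB (f : Fin 6 → RatFunc ℂ) : Prop :=
  ∃ i : Fin 6,
    PoleAtInfty (f i) ∧ PoleAtInfty (f (i + 1)) ∧ PoleAtInfty (f (i + 2)) ∧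
    PoleAtInfty (f (i + 3)) ∧ HoloAtInfty (f (i + 4)) ∧ HoloAtInfty (f (i + 5))

/-- `F` grows at most like `s ^ (-N)` at the puncture `s = 0`, with coefficient `a`. -/
def HasLead (F : ℂ → ℂ) (N : ℤ) (a : ℂ) : Prop :=
  Tendsto (fun s => s ^ N * F s) (𝓝[≠] 0) (𝓝 a)

namespace HasLead

variable {F G : ℂ → ℂ} {N M : ℤ} {a b c : ℂ}

theorem congr (h : HasLead F N a) (e : ∀ᶠ s in 𝓝[≠] 0, F s = G s) : HasLead G N a := by
  refine Tendsto.congr' ?_ h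
  filter_upwards [e] with s hs
  rw [hs]

theorem cast (h : HasLead F N a) (hN : N = M) (ha : a = b) : HasLead F M b :=
  hN ▸ ha ▸ h

theorem unique (h : HasLead F N a) (k : HasLead F N b) : a = b :=
  tendsto_nhds_unique h k

theorem add (h : HasLead F N a) (k : HasLead G N b) :
    HasLead (fun s => F s + G s) N (a + b) := by
  simpa only [HasLead, mul_add] using Tendsto.add h k

theorem sub (h : HasLead F N a) (k : HasLead G N b) :
    HasLead (fun s => F s - G s) N (a - b) := by
  simpa only [HasLead, mul_sub] using Tendsto.sub h k

theorem const_mul (c : ℂ) (h : HasLead F N a) : HasLead (fun s => c * F s) N (c * a) := by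
  simpa only [HasLead, mul_left_comm] using Tendsto.const_mul c h

theorem mul (h : HasLead F N a) (k : HasLead G M b) :
    HasLead (fun s => F s * G s) (N + M) (a * b) := by
  refine Tendsto.congr' ?_ (Tendsto.mul h k)
  filter_upwards [self_mem_nhdsWithin] with s hs
  rw [zpow_add₀ hs]
  ring

theorem of_lt (h : HasLead F N a) (hNM : N < M) : HasLead F M 0 := by
  have hz : Tendsto (fun s : ℂ => s ^ (M - N)) (𝓝[≠] 0) (𝓝 0) := by
    obtain ⟨k, hk⟩ := Int.eq_ofNat_of_zero_le (by lia : 0 ≤ M - N)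
    have hk0 : k ≠ 0 := by lia
    simp only [hk, zpow_natCast]
    have : Tendsto (fun s : ℂ => s ^ k) (𝓝 0) (𝓝 (0 ^ k)) := (continuous_pow k).tendsto 0
    rw [zero_pow hk0] at this
    exact this.mono_left nhdsWithin_le_nhds
  have h2 := hz.mul h
  rw [zero_mul] at h2
  refine Tendsto.congr' ?_ h2
  filter_upwards [self_mem_nhdsWithin] with s hs
  rw [← mul_assoc, ← zpow_add₀ hs, sub_add_cancel]

theorem cancel_left (h : HasLead F N a) (ha : a ≠ 0)
    (k : HasLead (fun s => F s * G s) (N + M) b) : HasLead G M (b / a) := by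
  refine Tendsto.congr' ?_ (Tendsto.div k h ha)
  filter_upwards [self_mem_nhdsWithin, h.eventually_ne ha] with s hs hs0
  have hF : F s ≠ 0 := right_ne_zero_of_mul hs0
  have hz : s ^ N ≠ 0 := zpow_ne_zero _ hs
  rw [Pi.div_apply, zpow_add₀ hs]
  field_simp

theorem exists_analyticAt (hF : MeromorphicAt F 0) (h : HasLead F N a) :
    ∃ g : ℂ → ℂ, AnalyticAt ℂ g 0 ∧ g 0 = a ∧ ∀ᶠ s in 𝓝[≠] 0, F s = s ^ (-N) * g s := by
  classical
  have hm : MeromorphicAt (fun s => s ^ N * F s) 0 := ((MeromorphicAt.id 0).zpow N).mul hF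
  refine ⟨Function.update (fun s => s ^ N * F s) 0 a,
    (hm.update 0 a).analyticAt (continuousAt_update_same.2 h), Function.update_self _ _ _, ?_⟩
  filter_upwards [self_mem_nhdsWithin] with s hs
  rw [Function.update_of_ne hs, ← mul_assoc, ← zpow_add₀ hs, neg_add_cancel, zpow_zero, one_mul]

theorem smul_deriv (hF : MeromorphicAt F 0) (h : HasLead F N a) :
    HasLead (fun s => s * deriv F s) N (-N * a) := by
  obtain ⟨g, hg, rfl, he⟩ := h.exists_analyticAt hF
  have hd := Filter.EventuallyEq.nhdsNE_deriv he
  have hlim : Tendsto (fun s => -N * g s + s * deriv g s) (𝓝[≠] 0) (𝓝 (-N * g 0)) := by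
    have : ContinuousAt (fun s => -N * g s + s * deriv g s) 0 :=
      (continuousAt_const.mul hg.continuousAt).add (continuousAt_id.mul hg.deriv.continuousAt)
    simpa using this.tendsto.mono_left nhdsWithin_le_nhds
  refine Tendsto.congr' ?_ hlim
  filter_upwards [hd, self_mem_nhdsWithin,
    hg.eventually_analyticAt.filter_mono nhdsWithin_le_nhds] with s h1 hs hgs
  rw [h1, ((hasDerivAt_zpow (-N) s (Or.inl hs)).fun_mul hgs.differentiableAt.hasDerivAt).deriv,
    zpow_sub_one₀ hs, zpow_neg]
  have hz : s ^ N ≠ 0 := zpow_ne_zero _ hs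
  have hs' : s ≠ 0 := hs
  push_cast
  field_simp

theorem exists_pred (hF : MeromorphicAt F 0) (h : HasLead F N 0) :
    ∃ b, HasLead F (N - 1) b := by
  obtain ⟨g, hg, h0, he⟩ := h.exists_analyticAt hF
  refine ⟨deriv g 0, ?_⟩
  refine Tendsto.congr' ?_ hg.differentiableAt.hasDerivAt.tendsto_slope
  filter_upwards [he, self_mem_nhdsWithin] with s h1 hs
  rw [h1, slope_def_field, h0, ← mul_assoc, ← zpow_add₀ hs, show N - 1 + -N = -1 by ring,
    zpow_neg_one, sub_zero, sub_zero, div_eq_inv_mul]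

theorem exists_of_meromorphicAt (hF : MeromorphicAt F 0) :
    ∃ N : ℤ, ∃ a, HasLead F N a := by
  obtain ⟨n, hn⟩ := hF
  refine ⟨n, _, Tendsto.mono_left hn.continuousAt.tendsto nhdsWithin_le_nhds |>.congr fun s => ?_⟩
  simp

theorem exists_ne_zero (hF : MeromorphicAt F 0) (hF0 : ¬ ∀ᶠ s in 𝓝[≠] 0, F s = 0) :
    ∃ N : ℤ, ∃ a, a ≠ 0 ∧ HasLead F N a := by
  rw [← meromorphicOrderAt_eq_top_iff, ← ne_eq, meromorphicOrderAt_ne_top_iff hF] at hF0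
  obtain ⟨g, hg, h0, he⟩ := hF0
  refine ⟨-(meromorphicOrderAt F 0).untop₀, g 0, h0, ?_⟩
  refine Tendsto.congr' ?_ (hg.continuousAt.tendsto.mono_left nhdsWithin_le_nhds)
  filter_upwards [he, self_mem_nhdsWithin] with s h1 hs
  rw [h1, sub_zero, smul_eq_mul, ← mul_assoc, ← zpow_add₀ hs, neg_add_cancel, zpow_zero, one_mul]

theorem exists_le {ι : Type*} [Finite ι] {F : ι → ℂ → ℂ} (hF : ∀ j, MeromorphicAt (F j) 0)
    (N₀ : ℤ) : ∃ N, N₀ ≤ N ∧ ∃ a : ι → ℂ, ∀ j, HasLead (F j) N (a j) := by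
  choose n a hn using fun j => exists_of_meromorphicAt (hF j)
  obtain ⟨M, hM⟩ := (Set.finite_range n).bddAbove
  refine ⟨max N₀ (M + 1), le_max_left _ _, 0, fun j => (hn j).of_lt ?_⟩
  have := hM ⟨j, rfl⟩
  lia

/-- Descent: if all simultaneous leading coefficients vanish above `N₀`, the growth is at most
`N₀`. -/
theorem exists_descent {ι : Type*} [Finite ι] {F : ι → ℂ → ℂ} (hF : ∀ j, MeromorphicAt (F j) 0)
    {N₀ : ℤ} (h : ∀ N, N₀ < N → ∀ a : ι → ℂ, (∀ j, HasLead (F j) N (a j)) → ∀ j, a j = 0) :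
    ∃ a : ι → ℂ, ∀ j, HasLead (F j) N₀ (a j) := by
  obtain ⟨N, hN, hex⟩ := exists_le hF N₀
  induction N, hN using Int.leInduction with
  | base => exact hex
  | succ N hN ih =>
    obtain ⟨a, ha⟩ := hex
    have h0 := h (N + 1) (by lia) a ha
    refine ih ?_
    choose b hb using fun j => exists_pred (hF j) (h0 j ▸ ha j)
    exact ⟨b, fun j => by simpa using hb j⟩

end HasLead

/-- The quadratic factor of the `j`-th equation, rewritten using the constraint `∑ = t`. -/
def bracket (x : Fin 6 → ℂ) (t : ℂ) (j : Fin 6) : ℂ :=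
  x (j + 2) * (2 * x (j + 1) - t) - x (j + 4) * (2 * x (j + 5) - t)

/-- Germs at a puncture solving the `A₅⁽¹⁾` system, where `T` is the independent variable written
in the local coordinate `s` and `t d/dt = ε s d/ds`. -/
structure LocalSolution (ε : ℂ) (T : ℂ → ℂ) (α : Fin 6 → ℂ) (F : Fin 6 → ℂ → ℂ) : Prop where
  mero : ∀ j, MeromorphicAt (F j) 0
  sum : ∀ j, ∀ᶠ s in 𝓝[≠] 0, F j s + F (j + 2) s + F (j + 4) s = T s
  ode : ∀ j, ∀ᶠ s in 𝓝[≠] 0, ε * (s / 2 * deriv (F j) s) =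
    F j s * bracket (fun k => F k s) (T s) j
      + (1 / 2 - α (j + 2) - α (j + 4)) * F j s + α j * (T s - F j s)

namespace LocalSolution

variable {ε : ℂ} {T : ℂ → ℂ} {α : Fin 6 → ℂ} {F G : Fin 6 → ℂ → ℂ}

theorem rotate (h : LocalSolution ε T α F) (k : Fin 6) :
    LocalSolution ε T (fun j => α (j + k)) (fun j => F (j + k)) where
  mero j := h.mero _
  sum j := by simpa only [add_right_comm] using h.sum (j + k)
  ode j := by simpa only [add_right_comm, bracket] using h.ode (j + k)

theorem ode_isolated (h : LocalSolution ε T α F) (j : Fin 6) :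
    ∀ᶠ s in 𝓝[≠] 0, ε / 2 * (s * deriv (F j) s) - (1 / 2 - α (j + 2) - α (j + 4)) * F j s
      - α j * (T s - F j s) = F j s * bracket (fun k => F k s) (T s) j := by
  filter_upwards [h.ode j] with s hs
  linear_combination hs

theorem hasLead_mul_bracket (h : LocalSolution ε T α F) {j : Fin 6} {N : ℤ} {a τ : ℂ}
    (hj : HasLead (F j) N a) (hT : HasLead T N τ) :
    HasLead (fun s => F j s * bracket (fun k => F k s) (T s) j) N
      (ε / 2 * (-N * a) - (1 / 2 - α (j + 2) - α (j + 4)) * a - α j * (τ - a)) :=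
  ((((hj.smul_deriv (h.mero j)).const_mul (ε / 2)).sub
    (hj.const_mul (1 / 2 - α (j + 2) - α (j + 4)))).sub
    ((hT.sub hj).const_mul (α j))).congr (h.ode_isolated j)

theorem hasLead_bracket (h : LocalSolution ε T α F) {j : Fin 6} {N : ℤ} {a τ : ℂ}
    (hj : HasLead (F j) N a) (ha : a ≠ 0) (hT : HasLead T N τ) :
    ∃ β, HasLead (fun s => bracket (fun k => F k s) (T s) j) 0 β :=
  ⟨_, hj.cancel_left ha ((h.hasLead_mul_bracket hj hT).cast (add_zero N).symm rfl)⟩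

theorem exists_hasLead_of_one_le (hT : HasLead T 1 1) {N : ℤ} (hN : 1 ≤ N) :
    ∃ τ, HasLead T N τ := by
  obtain rfl | h := hN.eq_or_lt
  · exact ⟨_, hT⟩
  · exact ⟨_, hT.of_lt h⟩

theorem mul_linear_eq_bracket_sub (h : LocalSolution ε T α F) (j : Fin 6) :
    ∀ᶠ s in 𝓝[≠] 0, bracket (fun k => F k s) (T s) j - bracket (fun k => F k s) (T s) (j + 2) =
      T s * (2 * F (j + 1) s + F (j + 4) s - T s) := by
  filter_upwards [h.sum j, h.sum (j + 1)] with s h0 h1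
  have e : ∀ j : Fin 6, j + 2 + 1 = j + 3 ∧ j + 2 + 2 = j + 4 ∧ j + 2 + 4 = j ∧ j + 2 + 5 = j + 1
      ∧ j + 1 + 2 = j + 3 ∧ j + 1 + 4 = j + 5 := by decide
  obtain ⟨e1, e2, e3, e4, e5, e6⟩ := e j
  simp only [bracket, e1, e2, e3, e4, e5, e6] at h1 ⊢
  linear_combination (2 * F (j + 1) s - T s) * h0 - 2 * F (j + 4) s * h1

theorem hasLead_linear (h : LocalSolution ε T α F) (hT : HasLead T 1 1) {N : ℤ} (hN : 1 ≤ N)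
    {j : Fin 6} {a b : ℂ} (hj : HasLead (F j) N a) (ha : a ≠ 0)
    (hj2 : HasLead (F (j + 2)) N b) (hb : b ≠ 0) :
    ∃ β, HasLead (fun s => 2 * F (j + 1) s + F (j + 4) s - T s) (-1) β := by
  obtain ⟨τ, hτ⟩ := exists_hasLead_of_one_le hT hN
  obtain ⟨β, hβ⟩ := h.hasLead_bracket hj ha hτ
  obtain ⟨γ, hγ⟩ := h.hasLead_bracket hj2 hb hτ
  exact ⟨_, hT.cancel_left one_ne_zero ((hβ.sub hγ).congr (h.mul_linear_eq_bracket_sub j))⟩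

theorem linear_eq_zero (h : LocalSolution ε T α F) (hT : HasLead T 1 1) {N M : ℤ} (hN : 1 ≤ N)
    (hM : 1 < M) {j : Fin 6} {a b c d : ℂ} (hj : HasLead (F j) N a) (ha : a ≠ 0)
    (hj2 : HasLead (F (j + 2)) N b) (hb : b ≠ 0)
    (hj1 : HasLead (F (j + 1)) M c) (hj4 : HasLead (F (j + 4)) M d) : 2 * c + d = 0 := by
  obtain ⟨β, hβ⟩ := h.hasLead_linear hT hN hj ha hj2 hb
  have := (((hj1.const_mul 2).add hj4).sub (hT.of_lt hM)).unique (hβ.of_lt (by lia))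
  simpa using this

theorem sum_eq_zero (h : LocalSolution ε T α F) (hT : HasLead T 1 1) {M : ℤ}
    (hM : 1 < M) {j : Fin 6} {a b c : ℂ} (hj : HasLead (F j) M a)
    (hj2 : HasLead (F (j + 2)) M b) (hj4 : HasLead (F (j + 4)) M c) : a + b + c = 0 :=
  (((hj.add hj2).add hj4).congr (h.sum j)).unique (hT.of_lt hM)

theorem sum_eq_one (h : LocalSolution ε T α F) (hT : HasLead T 1 1)
    {j : Fin 6} {a b c : ℂ} (hj : HasLead (F j) 1 a)
    (hj2 : HasLead (F (j + 2)) 1 b) (hj4 : HasLead (F (j + 4)) 1 c) : a + b + c = 1 :=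
  (((hj.add hj2).add hj4).congr (h.sum j)).unique hT

/-- If `F 0`, `F 2` dominate `F 4`, then no two of `F 1`, `F 3`, `F 5` grow faster than `T`. -/
theorem odd_eq_zero (h : LocalSolution ε T α F) (hT : HasLead T 1 1) {N K : ℤ} (hN : 1 < N)
    (hK : 1 < K) {a : Fin 6 → ℂ} (ha : ∀ j, HasLead (F j) N (a j)) (h0 : a 0 ≠ 0) (h2 : a 2 ≠ 0)
    (h4 : a 4 = 0) {b1 b3 b5 : ℂ} (hb1 : HasLead (F 1) K b1) (hb3 : HasLead (F 3) K b3)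
    (hb5 : HasLead (F 5) K b5) : b1 = 0 ∧ b3 = 0 ∧ b5 = 0 := by
  have hs : b1 + b3 + b5 = 0 := h.sum_eq_zero hT hK (j := 1) hb1 hb3 hb5
  have h1 : a 1 = 0 := by
    have := h.linear_eq_zero hT hN.le hN (j := 0) (ha 0) h0 (ha 2) h2 (ha 1) (ha 4)
    simpa [h4] using this
  have hb10 : b1 = 0 := by
    by_contra hb
    have hKN : K < N := by
      by_contra! hlt
      obtain rfl | hlt := hlt.eq_or_lt
      · exact hb (hb1.unique (h1 ▸ ha 1))
      · exact hb (hb1.unique ((ha 1).of_lt hlt))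
    by_cases hb' : b3 = 0
    · have hb'' : b5 ≠ 0 := by
        intro h5
        simp [hb', h5] at hs
        exact hb hs
      have := h.linear_eq_zero hT hK.le hN (j := 5) hb5 hb'' hb1 hb (ha 0) (hb3.of_lt hKN)
      simp [h0] at this
    · have := h.linear_eq_zero hT hK.le hN (j := 1) hb1 hb hb3 hb' (ha 2) (hb5.of_lt hKN)
      simp [h2] at this
  have hb35 : b3 = -b5 := by linear_combination hs - hb10
  by_cases hb5z : b5 = 0
  · simp [hb10, hb35, hb5z]
  exfalso
  obtain ⟨β, hβ⟩ := h.hasLead_linear hT hN.le (j := 0) (ha 0) h0 (ha 2) h2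
  obtain ⟨γ, hγ⟩ := h.hasLead_linear hT hK.le (j := 3) hb3 (by simpa [hb35]) hb5 hb5z
  have hβ' : HasLead (fun s => 2 * F 1 s + F 4 s - T s) 1 0 := hβ.of_lt (by lia)
  have hγ' : HasLead (fun s => 2 * F 4 s + F 1 s - T s) 1 0 := hγ.of_lt (by lia)
  have hF1 : HasLead (F 1) 1 (1 / 3) :=
    (((((hβ'.const_mul 2).sub hγ').add hT).const_mul (1 / 3)).congr
      (Eventually.of_forall fun s => by ring)).cast rfl (by ring)
  have hF4 : HasLead (F 4) 1 (1 / 3) :=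
    (((((hγ'.const_mul 2).sub hβ').add hT).const_mul (1 / 3)).congr
      (Eventually.of_forall fun s => by ring)).cast rfl (by ring)
  have hTN := hT.of_lt hN
  obtain ⟨β₀, hB0⟩ := h.hasLead_bracket (ha 0) h0 hTN
  obtain ⟨β₃, hB3⟩ := h.hasLead_bracket hb3 (by simpa [hb35]) (hT.of_lt hK)
  have e0 := (((ha 2).mul ((hF1.const_mul 2).sub hT)).sub
    ((hF4.mul (((ha 5).const_mul 2).sub hTN)).cast (add_comm _ _) rfl)).unique
    (hB0.of_lt (by lia))
  have e3 := (((ha 5).mul ((hF4.const_mul 2).sub hT)).sub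
    ((hF1.mul (((ha 2).const_mul 2).sub hTN)).cast (add_comm _ _) rfl)).unique
    (hB3.of_lt (by lia))
  exact h2 (by linear_combination e0 - 2 * e3)

theorem not_both_ne_zero (h : LocalSolution ε T α F) (hT : HasLead T 1 1) {N : ℤ} (hN : 1 < N)
    {a : Fin 6 → ℂ} (ha : ∀ j, HasLead (F j) N (a j)) (h0 : a 0 ≠ 0) (h2 : a 2 ≠ 0) : False := by
  have hlin0 : 2 * a 1 + a 4 = 0 :=
    h.linear_eq_zero hT hN.le hN (j := 0) (ha 0) h0 (ha 2) h2 (ha 1) (ha 4)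
  have hsum : a 0 + a 2 + a 4 = 0 := h.sum_eq_zero hT hN (j := 0) (ha 0) (ha 2) (ha 4)
  by_cases h4 : a 4 = 0
  · obtain ⟨b, hb⟩ := HasLead.exists_descent (F := ![F 1, F 3, F 5]) (N₀ := 1)
      (by intro j; fin_cases j <;> exact h.mero _) fun K hK b hb => by
        have := h.odd_eq_zero hT hN hK ha h0 h2 h4 (hb 0) (hb 1) (hb 2)
        intro j
        fin_cases j <;> simp [this]
    have hb1 : HasLead (F 1) 1 (b 0) := hb 0
    have hb3 : HasLead (F 3) 1 (b 1) := hb 1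
    have hb5 : HasLead (F 5) 1 (b 2) := hb 2
    have hs : b 0 + b 1 + b 2 = 1 := h.sum_eq_one hT (j := 1) hb1 hb3 hb5
    obtain ⟨β, hβ⟩ := h.hasLead_linear hT hN.le (j := 0) (ha 0) h0 (ha 2) h2
    have hβ' : HasLead (fun s => 2 * F 1 s + F 4 s - T s) 1 0 := hβ.of_lt (by lia)
    have hF4 : HasLead (F 4) 1 (1 - 2 * b 0) :=
      (((hβ'.add hT).sub (hb1.const_mul 2)).congr
        (Eventually.of_forall fun s => by ring)).cast rfl (by ring)
    have hTN := hT.of_lt hN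
    obtain ⟨β₀, hB0⟩ := h.hasLead_bracket (ha 0) h0 hTN
    have e0 := (((ha 2).mul ((hb1.const_mul 2).sub hT)).sub
      ((hF4.mul ((hb5.const_mul 2).sub hT)).of_lt (by lia))).unique (hB0.of_lt (by lia))
    have hb0 : b 0 = 1 / 2 := by
      have : 2 * b 0 - 1 = 0 := by simpa [h2] using e0
      linear_combination this / 2
    obtain ⟨β₁, hB1⟩ := h.hasLead_bracket hb1 (by simp [hb0]) hT
    have e1 := ((hb3.mul (((ha 2).const_mul 2).sub hTN)).sub
      (hb5.mul (((ha 0).const_mul 2).sub hTN))).unique (hB1.of_lt (by lia))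
    exact h2 (by linear_combination e1 + 2 * b 2 * (hsum - h4) - 2 * a 2 * (hs - hb0))
  · have hlin2 : 2 * a 3 + a 0 = 0 :=
      h.linear_eq_zero hT hN.le hN (j := 2) (ha 2) h2 (ha 4) h4 (ha 3) (ha 0)
    have hlin4 : 2 * a 5 + a 2 = 0 :=
      h.linear_eq_zero hT hN.le hN (j := 4) (ha 4) h4 (ha 0) h0 (ha 5) (ha 2)
    have hlin1 : 2 * a 2 + a 5 = 0 :=
      h.linear_eq_zero hT hN.le hN (j := 1) (ha 1)
        (fun h1 => h4 (by linear_combination hlin0 - 2 * h1)) (ha 3)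
        (fun h3 => h0 (by linear_combination hlin2 - 2 * h3)) (ha 2) (ha 5)
    exact h2 (by linear_combination 2 / 3 * hlin1 - hlin4 / 3)

theorem lead_zero_eq_zero (h : LocalSolution ε T α F) (hT : HasLead T 1 1) {N : ℤ} (hN : 1 < N)
    {a : Fin 6 → ℂ} (ha : ∀ j, HasLead (F j) N (a j)) : a 0 = 0 := by
  by_contra h0
  by_cases h2 : a 2 = 0
  · have hsum : a 0 + a 2 + a 4 = 0 := h.sum_eq_zero hT hN (j := 0) (ha 0) (ha 2) (ha 4)
    exact (h.rotate 4).not_both_ne_zero hT hN (a := fun j => a (j + 4)) (fun j => ha (j + 4))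
      (fun h4 : a 4 = 0 => h0 (by linear_combination hsum - h2 - h4)) h0
  · exact h.not_both_ne_zero hT hN ha h0 h2

theorem exists_hasLead_one (h : LocalSolution ε T α F) (hT : HasLead T 1 1) :
    ∃ a : Fin 6 → ℂ, ∀ j, HasLead (F j) 1 (a j) := by
  refine HasLead.exists_descent h.mero fun N hN a ha j => ?_
  have := (h.rotate j).lead_zero_eq_zero hT hN (a := fun k => a (k + j)) fun k => ha (k + j)
  simpa using this

/-- The differential of `bracket` at `a` applied to `x`, with the independent variable scaled to
`1`. -/
def bracketDeriv (a x : Fin 6 → ℂ) (j : Fin 6) : ℂ :=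
  x (j + 2) * (2 * a (j + 1) - 1) + a (j + 2) * (2 * x (j + 1))
    - x (j + 4) * (2 * a (j + 5) - 1) - a (j + 4) * (2 * x (j + 5))

set_option maxHeartbeats 4000000 in
-- a case split over the support of `a`
/-- The stationary points of the leading-order system are nondegenerate. -/
theorem eq_zero_of_bracketDeriv {a x : Fin 6 → ℂ} (hea : a 0 + a 2 + a 4 = 1)
    (hoa : a 1 + a 3 + a 5 = 1) (hex : x 0 + x 2 + x 4 = 0) (hox : x 1 + x 3 + x 5 = 0)
    (ha : ∀ j, a j * bracket a 1 j = 0)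
    (hx : ∀ j, x j * bracket a 1 j + a j * bracketDeriv a x j = 0) : x 0 = 0 := by
  have key : ∀ j, (a j = 0 ∧ x j * bracket a 1 j = 0) ∨
      (a j ≠ 0 ∧ bracket a 1 j = 0 ∧ bracketDeriv a x j = 0) := by
    intro j
    by_cases hj : a j = 0
    · exact Or.inl ⟨hj, by simpa [hj] using hx j⟩
    · have hb := (mul_eq_zero.1 (ha j)).resolve_left hj
      exact Or.inr ⟨hj, hb, by simpa [hb, hj] using hx j⟩
  have h0 : (a 0 = 0 ∧ x 0 * (a 2 * (2 * a 1 - 1) - a 4 * (2 * a 5 - 1)) = 0) ∨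
      (a 0 ≠ 0 ∧ a 2 * (2 * a 1 - 1) - a 4 * (2 * a 5 - 1) = 0 ∧
        x 2 * (2 * a 1 - 1) + a 2 * (2 * x 1) - x 4 * (2 * a 5 - 1) - a 4 * (2 * x 5) = 0) :=
    key 0
  have h1 : (a 1 = 0 ∧ x 1 * (a 3 * (2 * a 2 - 1) - a 5 * (2 * a 0 - 1)) = 0) ∨
      (a 1 ≠ 0 ∧ a 3 * (2 * a 2 - 1) - a 5 * (2 * a 0 - 1) = 0 ∧
        x 3 * (2 * a 2 - 1) + a 3 * (2 * x 2) - x 5 * (2 * a 0 - 1) - a 5 * (2 * x 0) = 0) :=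
    key 1
  have h2 : (a 2 = 0 ∧ x 2 * (a 4 * (2 * a 3 - 1) - a 0 * (2 * a 1 - 1)) = 0) ∨
      (a 2 ≠ 0 ∧ a 4 * (2 * a 3 - 1) - a 0 * (2 * a 1 - 1) = 0 ∧
        x 4 * (2 * a 3 - 1) + a 4 * (2 * x 3) - x 0 * (2 * a 1 - 1) - a 0 * (2 * x 1) = 0) :=
    key 2
  have h3 : (a 3 = 0 ∧ x 3 * (a 5 * (2 * a 4 - 1) - a 1 * (2 * a 2 - 1)) = 0) ∨
      (a 3 ≠ 0 ∧ a 5 * (2 * a 4 - 1) - a 1 * (2 * a 2 - 1) = 0 ∧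
        x 5 * (2 * a 4 - 1) + a 5 * (2 * x 4) - x 1 * (2 * a 2 - 1) - a 1 * (2 * x 2) = 0) :=
    key 3
  have h4 : (a 4 = 0 ∧ x 4 * (a 0 * (2 * a 5 - 1) - a 2 * (2 * a 3 - 1)) = 0) ∨
      (a 4 ≠ 0 ∧ a 0 * (2 * a 5 - 1) - a 2 * (2 * a 3 - 1) = 0 ∧
        x 0 * (2 * a 5 - 1) + a 0 * (2 * x 5) - x 2 * (2 * a 3 - 1) - a 2 * (2 * x 3) = 0) :=
    key 4
  have h5 : (a 5 = 0 ∧ x 5 * (a 1 * (2 * a 0 - 1) - a 3 * (2 * a 4 - 1)) = 0) ∨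
      (a 5 ≠ 0 ∧ a 1 * (2 * a 0 - 1) - a 3 * (2 * a 4 - 1) = 0 ∧
        x 1 * (2 * a 0 - 1) + a 1 * (2 * x 0) - x 3 * (2 * a 4 - 1) - a 3 * (2 * x 4) = 0) :=
    key 5
  clear ha hx key
  generalize a 0 = a0, a 1 = a1, a 2 = a2, a 3 = a3, a 4 = a4, a 5 = a5, x 0 = x0, x 1 = x1,
    x 2 = x2, x 3 = x3, x 4 = x4, x 5 = x5 at *
  rcases h0 with ⟨rfl, h0⟩ | ⟨z0, h0, k0⟩ <;> rcases h2 with ⟨rfl, h2⟩ | ⟨z2, h2, k2⟩ <;>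
  rcases h4 with ⟨rfl, h4⟩ | ⟨z4, h4, k4⟩ <;> rcases h1 with ⟨rfl, h1⟩ | ⟨z1, h1, k1⟩ <;>
  rcases h3 with ⟨rfl, h3⟩ | ⟨z3, h3, k3⟩ <;> rcases h5 with ⟨rfl, h5⟩ | ⟨z5, h5, k5⟩ <;> grind

theorem hasLead_bracket_one (hT : HasLead T 1 1) {a : Fin 6 → ℂ}
    (ha : ∀ j, HasLead (F j) 1 (a j)) (j : Fin 6) :
    HasLead (fun s => bracket (fun k => F k s) (T s) j) 2 (bracket a 1 j) :=
  ((ha _).mul (((ha _).const_mul 2).sub hT)).sub ((ha _).mul (((ha _).const_mul 2).sub hT))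

theorem mul_bracket_eq_zero (h : LocalSolution ε T α F) (hT : HasLead T 1 1) {a : Fin 6 → ℂ}
    (ha : ∀ j, HasLead (F j) 1 (a j)) (j : Fin 6) : a j * bracket a 1 j = 0 := by
  refine ((ha j).mul (hasLead_bracket_one hT ha j)).unique
    (HasLead.of_lt (((((ha j).smul_deriv (h.mero j)).const_mul (ε / 2)).sub
    ((ha j).const_mul (1 / 2 - α (j + 2) - α (j + 4)))).sub
    ((hT.sub (ha j)).const_mul (α j)) |>.congr (h.ode_isolated j)) (by lia))

theorem linearized_eq_zero (h : LocalSolution ε T α F) (k : LocalSolution ε T α G)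
    (hT : HasLead T 1 1) {a x : Fin 6 → ℂ} (ha : ∀ j, HasLead (F j) 1 (a j))
    (ka : ∀ j, HasLead (G j) 1 (a j)) {m : ℤ}
    (hx : ∀ j, HasLead (fun s => F j s - G j s) m (x j)) (j : Fin 6) :
    x j * bracket a 1 j + a j * bracketDeriv a x j = 0 := by
  have hd := (hx j).smul_deriv ((h.mero j).sub (k.mero j))
  have low := ((hd.const_mul (ε / 2)).sub
    ((hx j).const_mul (1 / 2 - α (j + 2) - α (j + 4) - α j)))
  have hD : HasLead (fun s => (F (j + 2) s - G (j + 2) s) * (2 * F (j + 1) s - T s)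
      + G (j + 2) s * (2 * (F (j + 1) s - G (j + 1) s))
      - (F (j + 4) s - G (j + 4) s) * (2 * F (j + 5) s - T s)
      - G (j + 4) s * (2 * (F (j + 5) s - G (j + 5) s))) (m + 1) (bracketDeriv a x j) :=
    (((((hx _).mul (((ha _).const_mul 2).sub hT))).add
      (((ka _).mul ((hx _).const_mul 2)).cast (add_comm _ _) rfl)).sub
      ((hx _).mul (((ha _).const_mul 2).sub hT))).sub
      (((ka _).mul ((hx _).const_mul 2)).cast (add_comm _ _) rfl)
  have high := ((hx j).mul (hasLead_bracket_one hT ha j)).add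
    (((ka j).mul hD).cast (by ring : _ = m + 2) rfl)
  refine high.unique ((low.of_lt (by lia : m < m + 2)).congr ?_)
  filter_upwards [h.ode j, k.ode j, (h.mero j).eventually_analyticAt,
    (k.mero j).eventually_analyticAt] with s h1 h2 h3 h4
  have hds : deriv (F j - G j) s = deriv (F j) s - deriv (G j) s :=
    deriv_sub h3.differentiableAt h4.differentiableAt
  simp only [bracket] at h1 h2 ⊢
  change ε / 2 * (s * deriv (F j - G j) s) - _ = _
  rw [hds]
  linear_combination h1 - h2

theorem lead_diff_zero_eq_zero (h : LocalSolution ε T α F) (k : LocalSolution ε T α G)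
    (hT : HasLead T 1 1) {a x : Fin 6 → ℂ} (ha : ∀ j, HasLead (F j) 1 (a j))
    (ka : ∀ j, HasLead (G j) 1 (a j)) {m : ℤ}
    (hx : ∀ j, HasLead (fun s => F j s - G j s) m (x j)) : x 0 = 0 := by
  have hsum : ∀ j, x j + x (j + 2) + x (j + 4) = 0 := by
    intro j
    refine (((hx j).add (hx (j + 2))).add (hx (j + 4))).unique (b := 0)
      (HasLead.congr (F := fun _ => 0) (by simp [HasLead]) ?_)
    filter_upwards [h.sum j, k.sum j] with s h1 h2
    linear_combination h2 - h1
  exact eq_zero_of_bracketDeriv (h.sum_eq_one hT (j := 0) (ha 0) (ha 2) (ha 4))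
    (h.sum_eq_one hT (j := 1) (ha 1) (ha 3) (ha 5)) (hsum 0) (hsum 1)
    (h.mul_bracket_eq_zero hT ha) (h.linearized_eq_zero k hT ha ka hx)

/-- A solution is determined by its leading coefficients at infinity. -/
theorem eventually_eq_of_lead_eq (h : LocalSolution ε T α F) (k : LocalSolution ε T α G)
    (hT : HasLead T 1 1) {a : Fin 6 → ℂ} (ha : ∀ j, HasLead (F j) 1 (a j))
    (ka : ∀ j, HasLead (G j) 1 (a j)) (j : Fin 6) : ∀ᶠ s in 𝓝[≠] 0, F j s = G j s := by
  have hm : ∀ j, MeromorphicAt (fun s => F j s - G j s) 0 := fun j => (h.mero j).sub (k.mero j)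
  by_contra hne
  obtain ⟨N, c, hc, hN⟩ := HasLead.exists_ne_zero (hm j) (by simpa only [sub_eq_zero] using hne)
  obtain ⟨x, hx⟩ := HasLead.exists_descent hm (N₀ := N - 1) fun m _ x hx i => by
    have := (h.rotate i).lead_diff_zero_eq_zero (k.rotate i) hT (a := fun l => a (l + i))
      (x := fun l => x (l + i)) (fun l => ha _) (fun l => ka _) (fun l => hx _)
    simpa using this
  exact hc (hN.unique ((hx j).of_lt (by lia)))

theorem tendsto_neg_punctured : Tendsto (fun s : ℂ => -s) (𝓝[≠] 0) (𝓝[≠] 0) := by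
  refine tendsto_nhdsWithin_iff.2 ⟨?_, ?_⟩
  · simpa using (continuous_neg.tendsto (0 : ℂ)).mono_left nhdsWithin_le_nhds
  · filter_upwards [self_mem_nhdsWithin] with s hs
    simpa using hs

theorem reflect (h : LocalSolution ε T α F) (hT : ∀ s, T (-s) = -T s) :
    LocalSolution ε T α (fun j s => -F j (-s)) where
  mero j := by
    have : MeromorphicAt (F j) (-0 : ℂ) := by simpa using h.mero j
    exact (this.comp_analyticAt (g := fun s : ℂ => -s) (by fun_prop)).neg
  sum j := by
    filter_upwards [tendsto_neg_punctured.eventually (h.sum j)] with s hs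
    rw [hT] at hs
    linear_combination -hs
  ode j := by
    filter_upwards [tendsto_neg_punctured.eventually (h.ode j)] with s hs
    have hd : deriv (fun s => -F j (-s)) s = deriv (F j) (-s) := by
      simp [deriv_comp_neg]
    rw [hT] at hs
    simp only [bracket, hd] at hs ⊢
    linear_combination -hs

/-- Every solution germ at infinity is odd. -/
theorem eventually_odd (h : LocalSolution ε T α F) (hT : HasLead T 1 1)
    (hT' : ∀ s, T (-s) = -T s) (j : Fin 6) : ∀ᶠ s in 𝓝[≠] 0, F j s = -F j (-s) := by
  obtain ⟨a, ha⟩ := h.exists_hasLead_one hT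
  refine h.eventually_eq_of_lead_eq (h.reflect hT') hT ha (fun j => ?_) j
  refine ((ha j).comp tendsto_neg_punctured).congr fun s => ?_
  simp

end LocalSolution

theorem hasLead_id : HasLead (fun s => s) (-1) 1 := by
  refine tendsto_const_nhds.congr' ?_
  filter_upwards [self_mem_nhdsWithin] with s hs
  rw [zpow_neg_one, inv_mul_cancel₀ hs]

theorem hasLead_inv : HasLead (fun s => s⁻¹) 1 1 := by
  refine tendsto_const_nhds.congr' ?_
  filter_upwards [self_mem_nhdsWithin] with s hs
  rw [zpow_one, mul_inv_cancel₀ hs]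

/-- Near `t = 0`, if `F 0` has a pole and `F 1`, `F 3`, `F 4`, `F 5` vanish, then the leading
coefficients are determined by the parameters. -/
theorem LocalSolution.hasLead_of_pole {α : Fin 6 → ℂ} {F : Fin 6 → ℂ → ℂ}
    (h : LocalSolution 1 (fun s => s) α F)
    (hα : α 0 + α 1 + α 2 + α 3 + α 4 + α 5 = 1)
    (h0 : Tendsto (fun s => ‖F 0 s‖) (𝓝[≠] 0) atTop)
    (h1 : HasLead (F 1) 0 0) (h3 : HasLead (F 3) 0 0) (h4 : HasLead (F 4) 0 0)
    (h5 : HasLead (F 5) 0 0) :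
    α 1 - α 3 - α 5 ≠ 0 ∧ HasLead (F 0) 1 (α 1 - α 3 - α 5) ∧
      HasLead (F 2) 1 (-(α 1 - α 3 - α 5)) ∧
      HasLead (F 1) (-1) (α 1 / (α 1 - α 3 - α 5)) ∧
      HasLead (F 3) (-1) (-α 3 / (α 1 - α 3 - α 5)) ∧
      HasLead (F 5) (-1) (-α 5 / (α 1 - α 3 - α 5)) := by
  obtain ⟨a1, k1⟩ := h1.exists_pred (h.mero 1)
  obtain ⟨a3, k3⟩ := h3.exists_pred (h.mero 3)
  obtain ⟨a4, k4⟩ := h4.exists_pred (h.mero 4)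
  obtain ⟨a5, k5⟩ := h5.exists_pred (h.mero 5)
  rw [zero_sub] at k1 k3 k4 k5
  have hT := hasLead_id
  have hnb : ∀ L, ¬ HasLead (F 0) 0 L := by
    intro L hL
    have : Tendsto (fun s => ‖F 0 s‖) (𝓝[≠] 0) (𝓝 ‖L‖) := by simpa [HasLead] using hL.norm
    exact not_tendsto_nhds_of_tendsto_atTop h0 _ this
  obtain ⟨n, c, hc, k0⟩ := HasLead.exists_ne_zero (h.mero 0) fun he =>
    hnb 0 (HasLead.congr (F := fun _ => 0) (by simp [HasLead]) (he.mono fun _ => Eq.symm))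
  have hn : 1 ≤ n := by
    by_contra! hlt
    obtain rfl | hlt := (by lia : n ≤ 0).eq_or_lt
    · exact hnb _ k0
    · exact hnb _ (k0.of_lt hlt)
  have hTn := hT.of_lt (by lia : -1 < n)
  have k2 : HasLead (F 2) n (-c) := by
    refine (((hTn.sub k0).sub (k4.of_lt (by lia))).congr ?_).cast rfl (by ring)
    filter_upwards [h.sum 0] with s hs
    have hs' : F 0 s + F 2 s + F 4 s = s := hs
    linear_combination -hs'
  have hsum : a1 + a3 + a5 = 1 := ((k1.add k3).add k5 |>.congr (h.sum 1)).unique hT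
  have e0 : HasLead (fun s => bracket (fun k => F k s) s 0) 0
      ((1 / 2 * (-n * c) - (1 / 2 - α 2 - α 4) * c - α 0 * (0 - c)) / c) :=
    k0.cancel_left hc ((h.hasLead_mul_bracket k0 hTn).cast (add_zero n).symm rfl)
  have b0 : HasLead (fun s => bracket (fun k => F k s) s 0) (n + -1) (-c * (2 * a1 - 1) - 0) :=
    (k2.mul ((k1.const_mul 2).sub hT)).sub
      ((k4.mul ((k5.const_mul 2).sub hT)).of_lt (by lia))
  obtain rfl | hn1 := hn.eq_or_lt
  · have r0 := b0.unique (e0.cast (by norm_num) rfl)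
    have hz : (-1 : ℤ) + -1 < -1 + 1 := by norm_num
    have b1 : HasLead (fun s => bracket (fun k => F k s) s 1) (-1 + 1)
        (a3 * (2 * -c - 0) - a5 * (2 * c - 0)) :=
      (k3.mul ((k2.const_mul 2).sub hTn)).sub (k5.mul ((k0.const_mul 2).sub hTn))
    have b3 : HasLead (fun s => bracket (fun k => F k s) s 3) (-1 + 1) (0 - a1 * (2 * -c - 0)) :=
      ((k5.mul ((k4.const_mul 2).sub hT)).of_lt hz).sub (k1.mul ((k2.const_mul 2).sub hTn))
    have b5 : HasLead (fun s => bracket (fun k => F k s) s 5) (-1 + 1) (a1 * (2 * c - 0) - 0) :=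
      (k1.mul ((k0.const_mul 2).sub hTn)).sub ((k3.mul ((k4.const_mul 2).sub hT)).of_lt hz)
    have hz' : (-1 : ℤ) + (-1 + 1) = -1 := by norm_num
    have r1 : _ = 1 / 2 * (-(-1 : ℤ) * a1) - (1 / 2 - α 3 - α 5) * a1 - α 1 * (1 - a1) :=
      ((k1.mul b1).cast hz' rfl).unique (h.hasLead_mul_bracket k1 hT)
    have r3 : _ = 1 / 2 * (-(-1 : ℤ) * a3) - (1 / 2 - α 5 - α 1) * a3 - α 3 * (1 - a3) :=
      ((k3.mul b3).cast hz' rfl).unique (h.hasLead_mul_bracket k3 hT)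
    have r5 : _ = 1 / 2 * (-(-1 : ℤ) * a5) - (1 / 2 - α 1 - α 3) * a5 - α 5 * (1 - a5) :=
      ((k5.mul b5).cast hz' rfl).unique (h.hasLead_mul_bracket k5 hT)
    push_cast at r0 r1 r3 r5
    rw [eq_div_iff hc] at r0
    have r0' : c * (2 * a1 - 1) = α 1 + α 3 + α 5 :=
      mul_right_cancel₀ hc (by linear_combination -r0 - c * hα)
    have q1 : c * a1 = α 1 := by linear_combination -r1 - 2 * c * a1 * hsum + a1 * r0'
    have hcr : c = α 1 - α 3 - α 5 := by linear_combination 2 * q1 - r0'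
    have q3 : c * a3 = -α 3 := by linear_combination r3 - a3 * r0'
    have q5 : c * a5 = -α 5 := by linear_combination r5 - a5 * r0'
    rw [← hcr, ← q1, ← q3, ← q5]
    refine ⟨hc, k0, k2, k1.cast rfl ?_, k3.cast rfl ?_, k5.cast rfl ?_⟩ <;> field_simp
  · exfalso
    have r0 := b0.unique (e0.of_lt (by lia))
    have ha1 : 2 * a1 - 1 = 0 := by simpa [hc] using r0
    have ha1' : a1 ≠ 0 := by rintro rfl; simp at ha1
    obtain ⟨β, hβ⟩ := h.hasLead_bracket k1 ha1' hT
    have r1 := ((k3.mul ((k2.const_mul 2).sub hTn)).sub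
      (k5.mul ((k0.const_mul 2).sub hTn))).unique (hβ.of_lt (by lia))
    exact hc (by linear_combination -r1 - 2 * c * hsum + c * ha1)

theorem evalR_eq_div (f : RatFunc ℂ) (t : ℂ) : evalR f t = f.num.eval t / f.denom.eval t :=
  rfl

theorem analyticAt_evalR {f : RatFunc ℂ} {t : ℂ} (h : DefinedAt f t) :
    AnalyticAt ℂ (evalR f) t :=
  (AnalyticOnNhd.eval_polynomial f.num t trivial).div
    (AnalyticOnNhd.eval_polynomial f.denom t trivial) h

theorem evalR_add {f g : RatFunc ℂ} {t : ℂ} (hf : DefinedAt f t) (hg : DefinedAt g t) :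
    evalR (f + g) t = evalR f t + evalR g t :=
  RatFunc.eval_add _ _ hf hg

theorem definedAt_add {f g : RatFunc ℂ} {t : ℂ} (hf : DefinedAt f t) (hg : DefinedAt g t) :
    DefinedAt (f + g) t := fun h0 => by
  obtain ⟨q, hq⟩ := RatFunc.denom_add_dvd f g
  have : (f.denom * g.denom).eval t = 0 := by rw [hq, Polynomial.eval_mul, h0, zero_mul]
  rw [Polynomial.eval_mul] at this
  exact mul_ne_zero hf hg this

theorem eventually_eval_ne_zero {p : ℂ[X]} (hp : p ≠ 0) :
    ∀ᶠ t in cofinite, p.eval t ≠ 0 :=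
  (Polynomial.finite_setOfPred_isRoot hp).eventually_cofinite_notMem

theorem tendsto_inv_punctured_cofinite : Tendsto (fun s : ℂ => s⁻¹) (𝓝[≠] 0) cofinite :=
  tendsto_inv₀_nhdsNE_zero.mono_right (Bornology.le_cofinite ℂ)

theorem eventually_definedAt (f : Fin 6 → RatFunc ℂ) :
    ∀ᶠ t in cofinite, ∀ j, DefinedAt (f j) t :=
  eventually_all.2 fun j => eventually_eval_ne_zero (f j).denom_ne_zero

theorem IsA5Solution.sum_eq {α : Fin 6 → ℂ} {f : Fin 6 → RatFunc ℂ} (h : IsA5Solution α f) {t : ℂ}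
    (ht : ∀ j, DefinedAt (f j) t) (j : Fin 6) :
    evalR (f j) t + evalR (f (j + 2)) t + evalR (f (j + 4)) t = t := by
  have hX : evalR RatFunc.X t = t := RatFunc.eval_X _ _
  have he : evalR (f 0) t + evalR (f 2) t + evalR (f 4) t = t := by
    rw [← evalR_add (ht 0) (ht 2), ← evalR_add (definedAt_add (ht 0) (ht 2)) (ht 4), h.1, hX]
  have ho : evalR (f 1) t + evalR (f 3) t + evalR (f 5) t = t := by
    rw [← evalR_add (ht 1) (ht 3), ← evalR_add (definedAt_add (ht 1) (ht 3)) (ht 5), h.2.1, hX]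
  fin_cases j
  · exact he
  · exact ho
  · exact (by ring : evalR (f 2) t + evalR (f 4) t + evalR (f 0) t = _).trans he
  · exact (by ring : evalR (f 3) t + evalR (f 5) t + evalR (f 1) t = _).trans ho
  · exact (by ring : evalR (f 4) t + evalR (f 0) t + evalR (f 2) t = _).trans he
  · exact (by ring : evalR (f 5) t + evalR (f 1) t + evalR (f 3) t = _).trans ho

theorem IsA5Solution.ode_bracket {α : Fin 6 → ℂ} {f : Fin 6 → RatFunc ℂ} (h : IsA5Solution α f)
    {t : ℂ} (ht : ∀ j, DefinedAt (f j) t) (j : Fin 6) :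
    t / 2 * deriv (evalR (f j)) t =
      evalR (f j) t * bracket (fun k => evalR (f k) t) t j
        + (1 / 2 - α (j + 2) - α (j + 4)) * evalR (f j) t + α j * (t - evalR (f j) t) := by
  have h0 := h.sum_eq ht j
  have h1 := h.sum_eq ht (j + 1)
  have e : ∀ j : Fin 6, j + 1 + 2 = j + 3 ∧ j + 1 + 4 = j + 5 := by decide
  rw [(e j).1, (e j).2] at h1
  rw [h.2.2 t ht j]
  simp only [bracket]
  linear_combination α j * h0
    - evalR (f j) t * (evalR (f (j + 2)) t - evalR (f (j + 4)) t) * h1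

theorem IsA5Solution.localSolution_zero {α : Fin 6 → ℂ} {f : Fin 6 → RatFunc ℂ}
    (h : IsA5Solution α f) : LocalSolution 1 (fun s => s) α (fun j => evalR (f j)) where
  mero j := (AnalyticOnNhd.eval_polynomial (f j).num 0 trivial).meromorphicAt.div
    (AnalyticOnNhd.eval_polynomial (f j).denom 0 trivial).meromorphicAt
  sum j := by
    filter_upwards [nhdsNE_le_cofinite 0 (eventually_definedAt f)] with s hs
    exact h.sum_eq hs j
  ode j := by
    filter_upwards [nhdsNE_le_cofinite 0 (eventually_definedAt f)] with s hs
    rw [one_mul]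
    exact h.ode_bracket hs j

theorem meromorphicAt_eval_inv (p : ℂ[X]) : MeromorphicAt (fun s => p.eval s⁻¹) (0 : ℂ) := by
  simp only [Polynomial.eval_eq_sum_range]
  exact MeromorphicAt.fun_sum fun n _ =>
    (MeromorphicAt.const (p.coeff n) 0).mul ((MeromorphicAt.id 0).inv.pow n)

theorem IsA5Solution.localSolution_infty {α : Fin 6 → ℂ} {f : Fin 6 → RatFunc ℂ}
    (h : IsA5Solution α f) :
    LocalSolution (-1) (fun s => s⁻¹) α (fun j s => evalR (f j) s⁻¹) where
  mero j := (meromorphicAt_eval_inv (f j).num).div (meromorphicAt_eval_inv (f j).denom)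
  sum j := by
    filter_upwards [tendsto_inv_punctured_cofinite.eventually (eventually_definedAt f)] with s hs
    exact h.sum_eq hs j
  ode j := by
    filter_upwards [tendsto_inv_punctured_cofinite.eventually (eventually_definedAt f),
      self_mem_nhdsWithin] with s hs hs0
    have hs0' : s ≠ 0 := hs0
    have hd : deriv (fun s => evalR (f j) s⁻¹) s = deriv (evalR (f j)) s⁻¹ * -(s ^ 2)⁻¹ :=
      ((analyticAt_evalR (hs j)).differentiableAt.hasDerivAt.comp s (hasDerivAt_inv hs0')).deriv
    rw [← h.ode_bracket hs j, hd]
    field_simp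

/-- Rational solutions are odd. -/
theorem IsA5Solution.eventually_odd {α : Fin 6 → ℂ} {f : Fin 6 → RatFunc ℂ}
    (h : IsA5Solution α f) (j : Fin 6) :
    ∀ᶠ t in 𝓝[≠] (0 : ℂ), evalR (f j) (-t) = -evalR (f j) t := by
  have hinf := h.localSolution_infty.eventually_odd hasLead_inv (fun s => inv_neg) j
  have hden : ∀ᶠ t : ℂ in cofinite, (f j).denom.eval t ≠ 0 :=
    eventually_eval_ne_zero (f j).denom_ne_zero
  set P : ℂ[X] := (f j).num * (f j).denom.comp (-X) + (f j).num.comp (-X) * (f j).denom with hP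
  have hP0 : P = 0 := by
    by_contra hne
    obtain ⟨s, h1, h2, h3, h4⟩ := (hinf.and
      ((tendsto_inv_punctured_cofinite.eventually (eventually_eval_ne_zero hne)).and
      ((tendsto_inv_punctured_cofinite.eventually hden).and
      (LocalSolution.tendsto_neg_punctured.eventually
        (tendsto_inv_punctured_cofinite.eventually hden))))).exists
    refine h2 ?_
    rw [inv_neg] at h4
    simp only [evalR_eq_div, inv_neg] at h1
    generalize s⁻¹ = t at h1 h3 h4 ⊢
    field_simp at h1
    simp only [hP, Polynomial.eval_add, Polynomial.eval_mul, Polynomial.eval_comp,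
      Polynomial.eval_neg, Polynomial.eval_X]
    linear_combination h1
  have hden0 := hden.filter_mono (nhdsNE_le_cofinite 0)
  filter_upwards [hden0, LocalSolution.tendsto_neg_punctured.eventually hden0] with t h1 h2
  have h3 : P.eval t = 0 := by rw [hP0, Polynomial.eval_zero]
  simp only [hP, Polynomial.eval_add, Polynomial.eval_mul, Polynomial.eval_comp,
    Polynomial.eval_neg, Polynomial.eval_X] at h3
  simp only [evalR_eq_div]
  field_simp
  linear_combination h3

theorem IsA5Solution.tendsto_zero_of_regularAt {α : Fin 6 → ℂ} {f : Fin 6 → RatFunc ℂ}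
    (h : IsA5Solution α f) {j : Fin 6} (hj : RegularAt (f j) 0) :
    Tendsto (evalR (f j)) (𝓝[≠] 0) (𝓝 0) := by
  obtain ⟨L, hL⟩ := hj
  have h1 := (hL.comp LocalSolution.tendsto_neg_punctured).congr' (h.eventually_odd j)
  have h2 : L = -L := tendsto_nhds_unique h1 hL.neg
  have hL0 : L = 0 := by linear_combination h2 / 2
  exact hL0 ▸ hL

/-- Laurent behaviour at `t = 0` when `f i, f (i+2)` have a pole at `0` and the other
components are regular there. -/
theorem stmt_15 (α : Fin 6 → ℂ) (f : Fin 6 → RatFunc ℂ) (i : Fin 6)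
    (hsum : α 0 + α 1 + α 2 + α 3 + α 4 + α 5 = 1)
    (hsol : IsA5Solution α f)
    (hpi : PoleAt (f i) 0) (hpi2 : PoleAt (f (i + 2)) 0)
    (hr1 : RegularAt (f (i + 1)) 0) (hr3 : RegularAt (f (i + 3)) 0)
    (hr4 : RegularAt (f (i + 4)) 0) (hr5 : RegularAt (f (i + 5)) 0) :
    α (i + 1) - α (i + 3) - α (i + 5) ≠ 0 ∧
    Tendsto (fun t => t * evalR (f i) t) (𝓝[≠] (0 : ℂ))
      (𝓝 (α (i + 1) - α (i + 3) - α (i + 5))) ∧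
    Tendsto (fun t => t * evalR (f (i + 2)) t) (𝓝[≠] (0 : ℂ))
      (𝓝 (-(α (i + 1) - α (i + 3) - α (i + 5)))) ∧
    Tendsto (fun t => evalR (f (i + 1)) t / t) (𝓝[≠] (0 : ℂ))
      (𝓝 (α (i + 1) / (α (i + 1) - α (i + 3) - α (i + 5)))) ∧
    Tendsto (fun t => evalR (f (i + 3)) t / t) (𝓝[≠] (0 : ℂ))
      (𝓝 (-α (i + 3) / (α (i + 1) - α (i + 3) - α (i + 5)))) ∧
    Tendsto (fun t => evalR (f (i + 5)) t / t) (𝓝[≠] (0 : ℂ))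
      (𝓝 (-α (i + 5) / (α (i + 1) - α (i + 3) - α (i + 5)))) ∧
    Tendsto (fun t => evalR (f (i + 4)) t) (𝓝[≠] (0 : ℂ)) (𝓝 0) := by
  have hsum' : α (0 + i) + α (1 + i) + α (2 + i) + α (3 + i) + α (4 + i) + α (5 + i) = 1 := by
    have := Equiv.sum_comp (Equiv.addRight i) α
    simp only [Fin.sum_univ_six, Equiv.coe_addRight] at this
    rw [this, hsum]
  have lead : ∀ j, RegularAt (f (i + j)) 0 → HasLead (evalR (f (j + i))) 0 0 := by
    intro j hj
    simpa [HasLead, add_comm j i] using hsol.tendsto_zero_of_regularAt hj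
  have main := (hsol.localSolution_zero.rotate i).hasLead_of_pole hsum'
    (by simpa only [zero_add, PoleAt] using hpi) (lead 1 hr1) (lead 3 hr3) (lead 4 hr4) (lead 5 hr5)
  simp only [add_comm _ i, add_zero, HasLead, zpow_one, zpow_neg_one] at main
  obtain ⟨m1, m2, m3, m4, m5, m6⟩ := main
  simp only [div_eq_inv_mul] at *
  exact ⟨m1, m2, m3, m4, m5, m6, hsol.tendsto_zero_of_regularAt hr4⟩
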